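/- Corollary (quadratic bound with the constant C*_a(p)). Assume in addition that 𝒥_{ij}(t) ≠ 0 for all (i,j) ∈ E and all t. Let p = (p_i)_{i∈V} be a time-independent probability vector (p_i ≥ 0, Σ_{i∈V} p_i = 1) such that Σ_{i∈V} p_i · (1/τ)∫₀^τ γ_i(t) dt = 0. Define C*_a(p) := (1/2) Σ_{(i,j)∈E} (1/τ)∫₀^τ [(p_i w_{ij}(t) − p_j w_{ji}(t))² / 𝒥_{ij}(t)] · log(𝒬_{ij}(t)/𝒬_{ji}(t)) dt. Then limsup_{y→y_{α,γ}, y≠y_{α,γ}} I_{α,γ}(y)/(y − y_{α,γ})² ≤ C*_a(p)/(4 y_{α,γ}²), where the limsup is taken in [0,∞]. -/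

import Mathlib

open MeasureTheory Filter
open scoped Topology ENNReal

/-- The function `Φ(q,p) = q log(q/p) − q + p` on `[0,∞) × [0,∞)` with values in `[0,∞]`,
with the conventions `Φ(0,p) = p` and `Φ(q,0) = ∞` for `q > 0`. -/
noncomputable def Phi (q p : ℝ) : ℝ≥0∞ :=
  if q = 0 then ENNReal.ofReal p
  else if p = 0 then ⊤
  else ENNReal.ofReal (q * Real.log (q / p) - q + p)

lemma two_div_add_le_log_div_sub {a b : ℝ} (ha : 0 < a) (hb : 0 < b) (hab : a ≠ b) :
    2 / (a + b) ≤ Real.log (a / b) / (a - b) := by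
  wlog h : b < a generalizing a b
  · have := this hb ha hab.symm (lt_of_le_of_ne (not_lt.mp h) hab)
    rwa [← inv_div a b, Real.log_inv, ← neg_sub a b, neg_div_neg_eq, add_comm] at this
  have hx : 0 ≤ (a - b) / b := div_nonneg (sub_nonneg.mpr h.le) hb.le
  have key := Real.le_log_one_add_of_nonneg hx
  have h1 : 1 + (a - b) / b = a / b := by field_simp; ring
  have h2 : 2 * ((a - b) / b) / ((a - b) / b + 2) = 2 / (a + b) * (a - b) := by
    have : (a - b) / b + 2 = (a + b) / b := by field_simp; ring
    rw [this]
    field_simp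
  rw [h1, h2] at key
  rwa [le_div_iff₀ (sub_pos.mpr h)]

lemma one_add_mul_log_one_add_sub_le {u : ℝ} (hu : |u| ≤ 1 / 3) :
    (1 + u) * Real.log (1 + u) - u ≤ u ^ 2 / 2 + 5 / 2 * |u| ^ 3 := by
  have h := Real.abs_log_sub_add_sum_range_le (x := -u) (by rw [abs_neg]; linarith) 2
  simp only [Finset.sum_range_succ, Finset.sum_range_zero, abs_neg, sub_neg_eq_add] at h
  have h0 : 0 ≤ |u| ^ 3 := by positivity
  have h1 : |u| ^ (2 + 1) / (1 - |u|) ≤ 3 / 2 * |u| ^ 3 := by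
    rw [div_le_iff₀ (by linarith)]
    nlinarith
  have h2 : Real.log (1 + u) ≤ u - u ^ 2 / 2 + 3 / 2 * |u| ^ 3 := by
    have := (le_abs_self _).trans (h.trans h1)
    norm_num at this
    linarith
  have hl := abs_le.mp hu
  have h3 : -u ^ 3 ≤ |u| ^ 3 := by
    rw [← abs_pow]; exact neg_le_abs _
  have h4 := mul_le_mul_of_nonneg_left h2 (show 0 ≤ 1 + u by linarith)
  nlinarith

lemma relEntropy_perturb_le {a s x c : ℝ} (ha : 0 < a) (hs : |s| ≤ c) (hx : |x| ≤ c)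
    (hc : c ≤ a / 4) :
    (a + s + x) * Real.log ((a + s + x) / (a + s)) - (a + s + x) + (a + s)
      ≤ x ^ 2 / (2 * a) + 8 * c ^ 3 / a ^ 2 := by
  have hs' := abs_le.mp hs
  have hc0 : 0 ≤ c := (abs_nonneg s).trans hs
  obtain ⟨P, hP⟩ : ∃ P, P = a + s := ⟨_, rfl⟩
  rw [← hP]
  have hPa : 3 / 4 * a ≤ P := by linarith
  have hP0 : 0 < P := by linarith
  have hu : |x / P| ≤ 1 / 3 := by
    rw [abs_div, abs_of_pos hP0, div_le_iff₀ hP0]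
    linarith
  have h := mul_le_mul_of_nonneg_left (one_add_mul_log_one_add_sub_le hu) hP0.le
  have e1 : 1 + x / P = (P + x) / P := by field_simp
  have e2 : P * ((1 + x / P) * Real.log (1 + x / P) - x / P)
      = (P + x) * Real.log ((P + x) / P) - (P + x) + P := by
    rw [e1]; field_simp; ring
  have e3 : P * ((x / P) ^ 2 / 2 + 5 / 2 * |x / P| ^ 3)
      = x ^ 2 / (2 * P) + 5 / 2 * |x| ^ 3 / P ^ 2 := by
    rw [abs_div, abs_of_pos hP0]; field_simp
  rw [e2, e3] at h
  refine h.trans ?_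
  have hx3 : |x| ^ 3 ≤ c ^ 3 := pow_le_pow_left₀ (abs_nonneg _) hx 3
  have hx2 : x ^ 2 ≤ c ^ 2 := by rw [← sq_abs]; exact pow_le_pow_left₀ (abs_nonneg _) hx 2
  have b1 : 5 / 2 * |x| ^ 3 / P ^ 2 ≤ 5 * c ^ 3 / a ^ 2 := by
    rw [div_le_div_iff₀ (by positivity) (by positivity)]
    have : a ^ 2 ≤ 2 * P ^ 2 := by nlinarith
    have := mul_le_mul hx3 this (by positivity) (by positivity)
    nlinarith
  have b2 : x ^ 2 / (2 * P) ≤ x ^ 2 / (2 * a) + c ^ 3 / a ^ 2 := by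
    have hd : x ^ 2 / (2 * P) - x ^ 2 / (2 * a) = x ^ 2 * (-s) / (2 * P * a) := by
      have : P ≠ 0 := hP0.ne'
      field_simp
      rw [hP]; ring
    have : x ^ 2 * (-s) / (2 * P * a) ≤ c ^ 3 / a ^ 2 := by
      rw [div_le_div_iff₀ (by positivity) (by positivity)]
      have i1 : x ^ 2 * (-s) ≤ c ^ 3 := by
        calc x ^ 2 * (-s) ≤ x ^ 2 * c := by gcongr; linarith
          _ ≤ c ^ 2 * c := by gcongr
          _ = c ^ 3 := by ring
      have i2 : a ^ 2 ≤ 2 * P * a := by nlinarith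
      calc x ^ 2 * (-s) * a ^ 2 ≤ c ^ 3 * a ^ 2 := by gcongr
        _ ≤ c ^ 3 * (2 * P * a) := by gcongr
    linarith
  have : 8 * c ^ 3 / a ^ 2 = 5 * c ^ 3 / a ^ 2 + c ^ 3 / a ^ 2 + 2 * (c ^ 3 / a ^ 2) := by ring
  have : 0 ≤ c ^ 3 / a ^ 2 := by positivity
  linarith

lemma Phi_perturb_le {a s x c : ℝ} (ha : 0 < a) (hs : |s| ≤ c) (hx : |x| ≤ c)
    (hc : c ≤ a / 4) :
    Phi (a + s + x) (a + s) ≤ ENNReal.ofReal (x ^ 2 / (2 * a) + 8 * c ^ 3 / a ^ 2) := by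
  have hs' := abs_le.mp hs
  have hx' := abs_le.mp hx
  rw [Phi, if_neg (by linarith), if_neg (by linarith)]
  exact ENNReal.ofReal_le_ofReal (relEntropy_perturb_le ha hs hx hc)

lemma exists_pos_abs_le_of_periodic {f : ℝ → ℝ} {τ : ℝ} (hτ : 0 < τ) (hf : Continuous f)
    (hp : Function.Periodic f τ) : ∃ B, 0 < B ∧ ∀ t, |f t| ≤ B := by
  obtain ⟨B, hB0, hB⟩ := (hp.isBounded_of_continuous hτ.ne' hf).exists_pos_norm_le
  exact ⟨B, hB0, fun t => hB _ ⟨t, rfl⟩⟩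

lemma exists_pos_le_of_periodic {f : ℝ → ℝ} {τ : ℝ} (hτ : 0 < τ) (hf : Continuous f)
    (hp : Function.Periodic f τ) (hpos : ∀ t, 0 < f t) : ∃ m, 0 < m ∧ ∀ t, m ≤ f t := by
  obtain ⟨_, ⟨t, rfl⟩, h⟩ :=
    (hp.compact_of_continuous hτ.ne' hf).exists_isLeast (Set.range_nonempty f)
  exact ⟨f t, hpos t, fun s => h ⟨s, rfl⟩⟩

lemma eventually_abs_mul_le (B : ℝ) {m : ℝ} (hm : 0 < m) :
    ∀ᶠ ε in 𝓝 (0 : ℝ), |ε| * B ≤ m := by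
  have : Tendsto (fun ε : ℝ => |ε| * B) (𝓝 0) (𝓝 (|0| * B)) :=
    (by fun_prop : Continuous fun ε : ℝ => |ε| * B).tendsto 0
  exact this.eventually_le_const (by simpa using hm)

lemma eventually_forall_add_mul_nonneg {f g : ℝ → ℝ} {τ : ℝ} (hτ : 0 < τ) (hf : Continuous f)
    (hfp : Function.Periodic f τ) (hpos : ∀ t, 0 < f t) (hg : Continuous g)
    (hgp : Function.Periodic g τ) : ∀ᶠ ε in 𝓝 (0 : ℝ), ∀ t, 0 ≤ f t + ε * g t := by
  obtain ⟨m, hm, hmf⟩ := exists_pos_le_of_periodic hτ hf hfp hpos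
  obtain ⟨B, -, hB⟩ := exists_pos_abs_le_of_periodic hτ hg hgp
  filter_upwards [eventually_abs_mul_le B hm] with ε hε t
  have h : |ε * g t| ≤ m := by
    rw [abs_mul]; exact (mul_le_mul_of_nonneg_left (hB t) (abs_nonneg ε)).trans hε
  linarith [(abs_le.mp h).1, hmf t]

lemma exists_lintegral_Phi_perturb_le {a r d : ℝ → ℝ} {τ : ℝ} (hτ : 0 < τ)
    (ha : Continuous a) (hap : Function.Periodic a τ) (hpos : ∀ t, 0 < a t)
    (hr : Continuous r) (hrp : Function.Periodic r τ)
    (hd : Continuous d) (hdp : Function.Periodic d τ) :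
    ∃ K, 0 ≤ K ∧ ∀ᶠ ε in 𝓝 (0 : ℝ),
      ∫⁻ t in Set.Ioc (0 : ℝ) τ, Phi (a t + ε * r t + ε * d t) (a t + ε * r t)
        ≤ ENNReal.ofReal (ε ^ 2 * ((∫ t in (0 : ℝ)..τ, d t ^ 2 / (2 * a t)) + K * |ε|)) := by
  obtain ⟨m, hm, hma⟩ := exists_pos_le_of_periodic hτ ha hap hpos
  obtain ⟨B₁, hB₁0, hB₁⟩ := exists_pos_abs_le_of_periodic hτ hr hrp
  obtain ⟨B₂, hB₂0, hB₂⟩ := exists_pos_abs_le_of_periodic hτ hd hdp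
  obtain ⟨B, hB⟩ : ∃ B, B = B₁ + B₂ := ⟨_, rfl⟩
  have hB0 : 0 < B := by linarith
  refine ⟨8 * B ^ 3 / m ^ 2 * τ, by positivity, ?_⟩
  filter_upwards [eventually_abs_mul_le B (show 0 < m / 4 by positivity)] with ε hε
  have hcont : Continuous fun t => d t ^ 2 / (2 * a t) :=
    (hd.pow 2).div (ha.const_mul 2) fun t => by have := hpos t; positivity
  set C := 8 * B ^ 3 / m ^ 2 * |ε| with hC
  have hC0 : 0 ≤ C := by positivity
  calc ∫⁻ t in Set.Ioc (0 : ℝ) τ, Phi (a t + ε * r t + ε * d t) (a t + ε * r t)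
      ≤ ∫⁻ t in Set.Ioc (0 : ℝ) τ, ENNReal.ofReal (ε ^ 2 * (d t ^ 2 / (2 * a t) + C)) := by
        refine lintegral_mono fun t => ?_
        have h1 : |ε * r t| ≤ |ε| * B := by
          rw [abs_mul]; exact mul_le_mul_of_nonneg_left (by linarith [hB₁ t]) (abs_nonneg ε)
        have h2 : |ε * d t| ≤ |ε| * B := by
          rw [abs_mul]; exact mul_le_mul_of_nonneg_left (by linarith [hB₂ t]) (abs_nonneg ε)
        refine (Phi_perturb_le (hpos t) h1 h2 (by linarith [hma t])).trans ?_
        refine ENNReal.ofReal_le_ofReal ?_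
        have h3 : 8 * (|ε| * B) ^ 3 / a t ^ 2 ≤ 8 * (|ε| * B) ^ 3 / m ^ 2 := by
          have := hma t
          gcongr
        have h4 : 8 * (|ε| * B) ^ 3 / m ^ 2 = ε ^ 2 * C := by
          rw [hC, ← sq_abs ε]; ring
        have h5 : (ε * d t) ^ 2 / (2 * a t) = ε ^ 2 * (d t ^ 2 / (2 * a t)) := by ring
        rw [h5]; linarith
    _ = ENNReal.ofReal (∫ t in Set.Ioc (0 : ℝ) τ, ε ^ 2 * (d t ^ 2 / (2 * a t) + C)) := by
        refine (ofReal_integral_eq_lintegral_ofReal ?_ ?_).symm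
        · exact ((hcont.add continuous_const).const_mul _).integrableOn_Ioc
        · exact ae_of_all _ fun t => by have := hpos t; positivity
    _ = _ := by
        rw [← intervalIntegral.integral_of_le hτ.le, intervalIntegral.integral_const_mul,
          intervalIntegral.integral_add (hcont.intervalIntegrable _ _)
            intervalIntegrable_const, intervalIntegral.integral_const, hC]
        congr 3
        simp; ring

lemma sum_sum_mul_eq_zero_of_antisymm {V : Type*} [Fintype V] {A X : V → V → ℝ}
    (hA : ∀ i j, A i j = -A j i) (hX : ∀ i j, X i j = X j i) :
    ∑ i, ∑ j, A i j * X i j = 0 := by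
  have h : ∑ i, ∑ j, A i j * X i j = -∑ i, ∑ j, A i j * X i j := by
    conv_lhs => rw [Finset.sum_comm]
    simp_rw [← Finset.sum_neg_distrib]
    refine Finset.sum_congr rfl fun i _ => Finset.sum_congr rfl fun j _ => ?_
    rw [hA j i, hX j i]; ring
  linarith

lemma sum_le_sum_of_swap {V : Type*} (E : Finset (V × V))
    (hE : ∀ i j, (i, j) ∈ E ↔ (j, i) ∈ E) {f g : V × V → ℝ}
    (h : ∀ e ∈ E, f e + f e.swap ≤ g e + g e.swap) : ∑ e ∈ E, f e ≤ ∑ e ∈ E, g e := by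
  have swap_sum (f : V × V → ℝ) : ∑ e ∈ E, f e.swap = ∑ e ∈ E, f e :=
    Finset.sum_nbij' Prod.swap Prod.swap (fun e he => (hE e.1 e.2).mp he)
      (fun e he => (hE e.1 e.2).mp he) (fun _ _ => rfl) (fun _ _ => rfl) (fun _ _ => rfl)
  have := Finset.sum_le_sum h
  simp_rw [Finset.sum_add_distrib, swap_sum] at this
  linarith

lemma sq_split_le_log {a b D : ℝ} (ha : 0 < a) (hb : 0 < b) (hab : a - b ≠ 0) :
    (D * (a / (a + b))) ^ 2 / (2 * a) + (D * (b / (a + b))) ^ 2 / (2 * b)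
      ≤ 1 / 4 * (D ^ 2 / (a - b) * Real.log (a / b)) := by
  have h := two_div_add_le_log_div_sub ha hb (sub_ne_zero.mp hab)
  have e1 : (D * (a / (a + b))) ^ 2 / (2 * a) + (D * (b / (a + b))) ^ 2 / (2 * b)
      = 1 / 4 * (D ^ 2 * (2 / (a + b))) := by
    field_simp; ring
  have e2 : D ^ 2 / (a - b) * Real.log (a / b) = D ^ 2 * (Real.log (a / b) / (a - b)) := by
    ring
  rw [e1, e2]
  gcongr

lemma limsup_div_sq_le {I : ℝ → ℝ≥0∞} {y₀ Λ K : ℝ} (hy₀ : y₀ ≠ 0)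
    (h : ∀ᶠ ε in 𝓝 (0 : ℝ), I (y₀ + ε * y₀) ≤ ENNReal.ofReal (ε ^ 2 * (Λ + K * |ε|))) :
    limsup (fun y => I y / ENNReal.ofReal ((y - y₀) ^ 2)) (𝓝[≠] y₀)
      ≤ ENNReal.ofReal (Λ / y₀ ^ 2) := by
  have hcont : Continuous fun y : ℝ => (y - y₀) / y₀ := by fun_prop
  have ht : Tendsto (fun y : ℝ => (y - y₀) / y₀) (𝓝[≠] y₀) (𝓝 0) := by
    have := hcont.tendsto y₀
    simp only [sub_self, zero_div] at this
    exact this.mono_left nhdsWithin_le_nhds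
  have hle : (fun y => I y / ENNReal.ofReal ((y - y₀) ^ 2)) ≤ᶠ[𝓝[≠] y₀]
      fun y => ENNReal.ofReal ((Λ + K * |(y - y₀) / y₀|) / y₀ ^ 2) := by
    filter_upwards [ht.eventually h, self_mem_nhdsWithin] with y hy hne
    have hne' : y - y₀ ≠ 0 := sub_ne_zero.mpr hne
    have e : y₀ + (y - y₀) / y₀ * y₀ = y := by field_simp; ring
    rw [e] at hy
    have hpos : 0 < (y - y₀) ^ 2 := by positivity
    refine (ENNReal.div_le_div_right hy _).trans ?_
    rw [← ENNReal.ofReal_div_of_pos hpos]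
    refine ENNReal.ofReal_le_ofReal (le_of_eq ?_)
    field_simp
  refine (limsup_le_limsup hle).trans (le_of_eq (Tendsto.limsup_eq ?_))
  refine ENNReal.tendsto_ofReal ?_
  have := ((ht.abs.const_mul K).const_add Λ).div_const (y₀ ^ 2)
  simpa using this

theorem stmt8
    {V : Type} [Fintype V] [Nonempty V]
    (E : Finset (V × V)) (hE : ∀ i : V, (i, i) ∉ E)
    (hE_symm : ∀ i j : V, (i, j) ∈ E ↔ (j, i) ∈ E)
    (τ : ℝ) (hτ : 0 < τ)
    (w : V → V → ℝ → ℝ)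
    (hw_cont : ∀ i j, Continuous (w i j))
    (hw_per : ∀ i j, Function.Periodic (w i j) τ)
    (hw_pos : ∀ i j, (i, j) ∈ E → ∀ t, 0 < w i j t)
    (hw_zero : ∀ i j, (i, j) ∉ E → ∀ t, w i j t = 0)
    (pi : V → ℝ → ℝ)
    (hpi_diff : ∀ i, ContDiff ℝ 1 (pi i))
    (hpi_per : ∀ i, Function.Periodic (pi i) τ)
    (hpi_pos : ∀ i t, 0 < pi i t)
    (hpi_sum : ∀ t : ℝ, ∑ i, pi i t = 1)
    (hpi_cont_eq : ∀ i t, deriv (pi i) t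
      + (∑ j, pi i t * w i j t) - (∑ j, pi j t * w j i t) = 0)
    (hJ_ne : ∀ i j, (i, j) ∈ E → ∀ t : ℝ,
      pi i t * w i j t - pi j t * w j i t ≠ 0)
    (α : V → V → ℝ → ℝ)
    (hα_cont : ∀ i j, Continuous (α i j))
    (hα_per : ∀ i j, Function.Periodic (α i j) τ)
    (hα_anti : ∀ i j (t : ℝ), α i j t = - α j i t)
    (γ : V → ℝ → ℝ)
    (hγ_cont : ∀ i, Continuous (γ i))
    (hγ_per : ∀ i, Function.Periodic (γ i) τ)
    (y0 : ℝ)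
    (hy0 : y0 = (1 / τ) * (∫ t in (0:ℝ)..τ,
      ((∑ i, ∑ j, α i j t * (pi i t * w i j t)) + ∑ i, γ i t * pi i t)))
    (hy0_ne : y0 ≠ 0)
    (Iag : ℝ → ℝ≥0∞)
    (hI : ∀ y : ℝ, Iag y = sInf { c : ℝ≥0∞ |
      ∃ (Q : V → V → ℝ → ℝ) (ρ : V → ℝ → ℝ),
        (∀ i j, Continuous (Q i j)) ∧
        (∀ i j, Function.Periodic (Q i j) τ) ∧
        (∀ i j t, 0 ≤ Q i j t) ∧
        (∀ i j, (i, j) ∉ E → ∀ t, Q i j t = 0) ∧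
        (∀ i, ContDiff ℝ 1 (ρ i)) ∧
        (∀ i, Function.Periodic (ρ i) τ) ∧
        (∀ i t, 0 ≤ ρ i t) ∧
        (∀ t : ℝ, ∑ i, ρ i t = 1) ∧
        (∀ i t, deriv (ρ i) t + (∑ j, Q i j t) - (∑ j, Q j i t) = 0) ∧
        ((1 / τ) * (∫ t in (0:ℝ)..τ,
          ((∑ i, ∑ j, α i j t * Q i j t) + ∑ i, γ i t * ρ i t)) = y) ∧
        c = ∑ e ∈ E, ENNReal.ofReal (1 / τ) *
          (∫⁻ t in Set.Ioc (0:ℝ) τ, Phi (Q e.1 e.2 t) (ρ e.1 t * w e.1 e.2 t)) })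
    -- the probability vector p
    (p : V → ℝ) (hp_nonneg : ∀ i, 0 ≤ p i) (hp_sum : ∑ i, p i = 1)
    (hp_γ : ∑ i, p i * ((1 / τ) * (∫ t in (0:ℝ)..τ, γ i t)) = 0)
    (Castar : ℝ)
    (hCastar : Castar = (1 / 2) * ∑ e ∈ E, (1 / τ) * (∫ t in (0:ℝ)..τ,
      ((p e.1 * w e.1 e.2 t - p e.2 * w e.2 e.1 t) ^ 2
          / (pi e.1 t * w e.1 e.2 t - pi e.2 t * w e.2 e.1 t)) *
        Real.log ((pi e.1 t * w e.1 e.2 t) / (pi e.2 t * w e.2 e.1 t)))) :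
    Filter.limsup (fun y : ℝ => Iag y / ENNReal.ofReal ((y - y0) ^ 2)) (𝓝[≠] y0)
      ≤ ENNReal.ofReal (Castar / (4 * y0 ^ 2)) := by
  have hpi_cont : ∀ i, Continuous (pi i) := fun i => (hpi_diff i).continuous
  have hw_swap : ∀ i j, (i, j) ∉ E → ∀ t, w j i t = 0 := fun i j h =>
    hw_zero j i fun h' => h ((hE_symm i j).mpr h')
  let a : V → V → ℝ → ℝ := fun i j t => pi i t * w i j t
  let r : V → V → ℝ → ℝ := fun i j t => (pi i t - p i) * w i j t
  let D : V → V → ℝ → ℝ := fun i j t => p i * w i j t - p j * w j i t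
  let d : V → V → ℝ → ℝ := fun i j t => D i j t * (a i j t / (a i j t + a j i t))
  have ha_cont : ∀ i j, Continuous (a i j) := fun i j => (hpi_cont i).mul (hw_cont i j)
  have ha_per : ∀ i j, Function.Periodic (a i j) τ := fun i j => (hpi_per i).mul (hw_per i j)
  have ha_pos : ∀ i j, (i, j) ∈ E → ∀ t, 0 < a i j t := fun i j h t =>
    mul_pos (hpi_pos i t) (hw_pos i j h t)
  have hr_cont : ∀ i j, Continuous (r i j) := fun i j =>
    ((hpi_cont i).sub continuous_const).mul (hw_cont i j)
  have hr_per : ∀ i j, Function.Periodic (r i j) τ := fun i j t => by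
    simp only [r, hpi_per i t, hw_per i j t]
  have hD_cont : ∀ i j, Continuous (D i j) := fun i j =>
    ((hw_cont i j).const_mul _).sub ((hw_cont j i).const_mul _)
  have hd_zero : ∀ i j, (i, j) ∉ E → ∀ t, d i j t = 0 := fun i j h t => by
    simp [d, a, hw_zero i j h t]
  have hd_cont : ∀ i j, Continuous (d i j) := fun i j => by
    by_cases h : (i, j) ∈ E
    · refine (hD_cont i j).mul ((ha_cont i j).div ((ha_cont i j).add (ha_cont j i)) fun t => ?_)
      exact (add_pos (ha_pos i j h t) (ha_pos j i ((hE_symm i j).mp h) t)).ne'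
    · rw [show d i j = fun _ => 0 from funext (hd_zero i j h)]
      exact continuous_const
  have hd_per : ∀ i j, Function.Periodic (d i j) τ := fun i j t => by
    simp only [d, D, a, hpi_per _ t, hw_per _ _ t]
  have hrd : ∀ i j t, r i j t + d i j t - (r j i t + d j i t) = a i j t - a j i t := by
    intro i j t
    by_cases h : (i, j) ∈ E
    · have h1 := ha_pos i j h t
      have h2 := ha_pos j i ((hE_symm i j).mp h) t
      have hd1 : d i j t - d j i t = D i j t := by
        have : D j i t = -D i j t := by simp only [D]; ring
        simp only [d, this]
        have h3 : a i j t + a j i t ≠ 0 := (add_pos h1 h2).ne'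
        rw [add_comm (a j i t) (a i j t), neg_mul, sub_neg_eq_add, ← mul_add, ← add_div,
          div_self h3, mul_one]
      have : D i j t = a i j t - a j i t - (r i j t - r j i t) := by
        simp only [D, a, r]; ring
      linarith
    · simp [r, d, a, hw_zero i j h t, hw_swap i j h t]
  let ρ : ℝ → V → ℝ → ℝ := fun ε i t => pi i t + ε * (pi i t - p i)
  let Q : ℝ → V → V → ℝ → ℝ := fun ε i j t => a i j t + ε * r i j t + ε * d i j t
  have hρw : ∀ ε i j t, ρ ε i t * w i j t = a i j t + ε * r i j t := fun ε i j t => by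
    simp only [ρ, a, r]; ring
  have hQ_sub : ∀ ε i j t, Q ε i j t - Q ε j i t = (1 + ε) * (a i j t - a j i t) :=
    fun ε i j t => by
      simp only [Q]
      linear_combination ε * hrd i j t
  have hobs : ∀ ε, (1 / τ) * (∫ t in (0:ℝ)..τ,
      ((∑ i, ∑ j, α i j t * Q ε i j t) + ∑ i, γ i t * ρ ε i t)) = y0 + ε * y0 := by
    intro ε
    have hpt : ∀ t, (∑ i, ∑ j, α i j t * Q ε i j t) + ∑ i, γ i t * ρ ε i t
        = (1 + ε) * ((∑ i, ∑ j, α i j t * (pi i t * w i j t)) + ∑ i, γ i t * pi i t)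
          - ε * ∑ i, p i * γ i t := by
      intro t
      have h1 := sum_sum_mul_eq_zero_of_antisymm (A := fun i j => α i j t)
        (X := fun i j => Q ε i j t - (1 + ε) * a i j t) (fun i j => hα_anti i j t)
        (fun i j => by linear_combination hQ_sub ε i j t)
      have h2 : ∑ i, ∑ j, α i j t * Q ε i j t
          = (1 + ε) * ∑ i, ∑ j, α i j t * (pi i t * w i j t) := by
        rw [← sub_eq_zero, ← h1]
        simp only [Finset.mul_sum, ← Finset.sum_sub_distrib]
        refine Finset.sum_congr rfl fun i _ => Finset.sum_congr rfl fun j _ => ?_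
        simp only [a]; ring
      have h3 : ∑ i, γ i t * ρ ε i t
          = (1 + ε) * ∑ i, γ i t * pi i t - ε * ∑ i, p i * γ i t := by
        simp only [Finset.mul_sum, ← Finset.sum_sub_distrib]
        refine Finset.sum_congr rfl fun i _ => ?_
        simp only [ρ]; ring
      rw [h2, h3]; ring
    have hγ0 : (1 / τ) * ∫ t in (0:ℝ)..τ, ∑ i, p i * γ i t = 0 := by
      rw [intervalIntegral.integral_finsetSum
        fun i _ => ((hγ_cont i).const_mul (p i)).intervalIntegrable _ _, Finset.mul_sum]
      refine (Finset.sum_congr rfl fun i _ => ?_).trans hp_γ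
      rw [intervalIntegral.integral_const_mul]; ring
    have hc1 : Continuous fun t =>
        (∑ i, ∑ j, α i j t * (pi i t * w i j t)) + ∑ i, γ i t * pi i t := by
      fun_prop
    have hc2 : Continuous fun t => ∑ i, p i * γ i t := by fun_prop
    simp_rw [hpt]
    rw [intervalIntegral.integral_sub ((hc1.const_mul _).intervalIntegrable _ _)
      ((hc2.const_mul _).intervalIntegrable _ _), intervalIntegral.integral_const_mul,
      intervalIntegral.integral_const_mul]
    linear_combination (-ε) * hγ0 - (1 + ε) * hy0
  have hI_le : ∀ ε, (∀ i t, 0 ≤ ρ ε i t) → (∀ i j t, 0 ≤ Q ε i j t) →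
      Iag (y0 + ε * y0) ≤ ∑ e ∈ E, ENNReal.ofReal (1 / τ) *
        (∫⁻ t in Set.Ioc (0:ℝ) τ, Phi (Q ε e.1 e.2 t) (a e.1 e.2 t + ε * r e.1 e.2 t)) := by
    intro ε hρ0 hQ0
    rw [hI]
    refine sInf_le ⟨Q ε, ρ ε, fun i j => ?_, fun i j t => ?_, hQ0, fun i j h t => ?_, fun i => ?_,
      fun i t => ?_, hρ0, fun t => ?_, fun i t => ?_, hobs ε, ?_⟩
    · exact ((ha_cont i j).add ((hr_cont i j).const_mul ε)).add ((hd_cont i j).const_mul ε)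
    · simp only [Q, ha_per i j t, hr_per i j t, hd_per i j t]
    · simp [Q, a, r, hd_zero i j h t, hw_zero i j h t]
    · exact (hpi_diff i).add (contDiff_const.mul ((hpi_diff i).sub contDiff_const))
    · simp only [ρ, hpi_per i t]
    · simp only [ρ, Finset.sum_add_distrib, ← Finset.mul_sum, Finset.sum_sub_distrib, hpi_sum,
        hp_sum]
      ring
    · have hdiff : HasDerivAt (pi i) (deriv (pi i) t) t :=
        ((hpi_diff i).differentiable one_ne_zero t).hasDerivAt
      have hder : deriv (ρ ε i) t = (1 + ε) * deriv (pi i) t := by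
        refine (hdiff.add ((hdiff.sub_const (p i)).const_mul ε)).deriv.trans ?_
        ring
      have h1 : (∑ j, Q ε i j t) - (∑ j, Q ε j i t)
          = (1 + ε) * ((∑ j, pi i t * w i j t) - (∑ j, pi j t * w j i t)) := by
        simp only [← Finset.sum_sub_distrib, Finset.mul_sum, hQ_sub, a]
      rw [hder, add_sub_assoc, h1]
      linear_combination (1 + ε) * hpi_cont_eq i t
    · simp only [hρw]
  have hρ_ev : ∀ᶠ ε in 𝓝 (0:ℝ), ∀ i t, 0 ≤ ρ ε i t := by
    refine eventually_all.mpr fun i => ?_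
    exact eventually_forall_add_mul_nonneg hτ (hpi_cont i) (hpi_per i) (hpi_pos i)
      ((hpi_cont i).sub continuous_const) fun t => by simp only [hpi_per i t]
  have hQ_ev : ∀ᶠ ε in 𝓝 (0:ℝ), ∀ i j t, 0 ≤ Q ε i j t := by
    refine eventually_all.mpr fun i => eventually_all.mpr fun j => ?_
    by_cases h : (i, j) ∈ E
    · filter_upwards [eventually_forall_add_mul_nonneg hτ (ha_cont i j) (ha_per i j)
        (ha_pos i j h) ((hr_cont i j).add (hd_cont i j)) ((hr_per i j).add (hd_per i j))]
        with ε hε t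
      have := hε t
      simp only [Pi.add_apply] at this
      simp only [Q]
      linarith
    · refine Eventually.of_forall fun ε t => le_of_eq ?_
      simp [Q, a, r, hd_zero i j h t, hw_zero i j h t]
  let L : V × V → ℝ → ℝ := fun e t => d e.1 e.2 t ^ 2 / (2 * a e.1 e.2 t)
  have hcost : ∀ e : V × V, ∃ K, 0 ≤ K ∧ (e ∈ E → ∀ᶠ ε in 𝓝 (0:ℝ),
      ∫⁻ t in Set.Ioc (0:ℝ) τ, Phi (Q ε e.1 e.2 t) (a e.1 e.2 t + ε * r e.1 e.2 t)
        ≤ ENNReal.ofReal (ε ^ 2 * ((∫ t in (0:ℝ)..τ, L e t) + K * |ε|))) := by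
    intro e
    by_cases h : e ∈ E
    · obtain ⟨K, hK0, hK⟩ := exists_lintegral_Phi_perturb_le hτ (ha_cont e.1 e.2) (ha_per e.1 e.2)
        (ha_pos e.1 e.2 h) (hr_cont e.1 e.2) (hr_per e.1 e.2) (hd_cont e.1 e.2) (hd_per e.1 e.2)
      exact ⟨K, hK0, fun _ => hK⟩
    · exact ⟨0, le_rfl, fun h' => absurd h' h⟩
  choose K hK0 hK using hcost
  have hL_cont : ∀ e ∈ E, Continuous (L e) := fun e he =>
    ((hd_cont _ _).pow 2).div ((ha_cont _ _).const_mul 2) fun t => by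
      have := ha_pos e.1 e.2 he t
      positivity
  have hL_nonneg : ∀ e ∈ E, ∀ t, 0 ≤ L e t := fun e he t => by
    have := ha_pos e.1 e.2 he t
    simp only [L]
    positivity
  have hX_nonneg : ∀ e ∈ E, 0 ≤ ∫ t in (0:ℝ)..τ, L e t := fun e he =>
    intervalIntegral.integral_nonneg hτ.le fun t _ => hL_nonneg e he t
  have hquad : ∀ᶠ ε in 𝓝 (0:ℝ), Iag (y0 + ε * y0) ≤ ENNReal.ofReal (ε ^ 2 *
      ((∑ e ∈ E, (1 / τ) * ∫ t in (0:ℝ)..τ, L e t) + (∑ e ∈ E, (1 / τ) * K e) * |ε|)) := by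
    filter_upwards [hρ_ev, hQ_ev, (eventually_all_finset E).mpr hK] with ε h1 h2 h3
    refine (hI_le ε h1 h2).trans ?_
    have e1 : ε ^ 2 *
        ((∑ e ∈ E, (1 / τ) * ∫ t in (0:ℝ)..τ, L e t) + (∑ e ∈ E, (1 / τ) * K e) * |ε|)
        = ∑ e ∈ E, (1 / τ) * (ε ^ 2 * ((∫ t in (0:ℝ)..τ, L e t) + K e * |ε|)) := by
      rw [Finset.sum_mul, ← Finset.sum_add_distrib, Finset.mul_sum]
      exact Finset.sum_congr rfl fun e _ => by ring
    rw [e1, ENNReal.ofReal_sum_of_nonneg fun e he => by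
      have := hX_nonneg e he
      have := hK0 e
      positivity]
    refine Finset.sum_le_sum fun e he => ?_
    rw [ENNReal.ofReal_mul (by positivity)]
    gcongr
    exact h3 e he
  refine (limsup_div_sq_le hy0_ne hquad).trans (ENNReal.ofReal_le_ofReal ?_)
  let R : V × V → ℝ → ℝ := fun e t => D e.1 e.2 t ^ 2 / (a e.1 e.2 t - a e.2 e.1 t) *
    Real.log (a e.1 e.2 t / a e.2 e.1 t)
  have hR_cont : ∀ e ∈ E, Continuous (R e) := fun e he => by
    have hpos' := ha_pos e.2 e.1 ((hE_symm e.1 e.2).mp he)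
    refine (((hD_cont _ _).pow 2).div ((ha_cont _ _).sub (ha_cont _ _))
      (hJ_ne e.1 e.2 he)).mul (((ha_cont _ _).div (ha_cont _ _) fun t => (hpos' t).ne').log
        fun t => ?_)
    exact (div_pos (ha_pos e.1 e.2 he t) (hpos' t)).ne'
  have hR_swap : ∀ e t, R e.swap t = R e t := fun e t => by
    have hD' : D e.2 e.1 t ^ 2 = D e.1 e.2 t ^ 2 := by simp only [D]; ring
    simp only [R, Prod.fst_swap, Prod.snd_swap]
    rw [hD', ← inv_div (a e.1 e.2 t), Real.log_inv, ← neg_sub (a e.1 e.2 t), div_neg, neg_mul_neg]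
  have hLR : ∑ e ∈ E, (1 / τ) * (∫ t in (0:ℝ)..τ, L e t)
      ≤ ∑ e ∈ E, (1 / 8) * ((1 / τ) * ∫ t in (0:ℝ)..τ, R e t) := by
    refine sum_le_sum_of_swap E hE_symm fun e he => ?_
    have he' : e.swap ∈ E := (hE_symm e.1 e.2).mp he
    have hi : IntervalIntegrable (L e) volume 0 τ := (hL_cont e he).intervalIntegrable _ _
    have hi' : IntervalIntegrable (L e.swap) volume 0 τ :=
      (hL_cont _ he').intervalIntegrable _ _
    have hint : (∫ t in (0:ℝ)..τ, L e t) + (∫ t in (0:ℝ)..τ, L e.swap t)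
        ≤ 1 / 4 * ∫ t in (0:ℝ)..τ, R e t := by
      rw [← intervalIntegral.integral_add hi hi', ← intervalIntegral.integral_const_mul]
      refine intervalIntegral.integral_mono_on hτ.le (hi.add hi')
        (((hR_cont e he).const_mul _).intervalIntegrable _ _) fun t _ => ?_
      have hD' : D e.2 e.1 t = -D e.1 e.2 t := by simp only [D]; ring
      have := sq_split_le_log (D := D e.1 e.2 t) (ha_pos e.1 e.2 he t)
        (ha_pos e.2 e.1 he' t) (hJ_ne e.1 e.2 he t)
      simpa only [L, R, d, Prod.fst_swap, Prod.snd_swap, hD', neg_mul, neg_sq,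
        add_comm (a e.2 e.1 t)] using this
    simp only [hR_swap]
    have := mul_le_mul_of_nonneg_left hint (one_div_nonneg.mpr hτ.le)
    linarith
  have hC : ∑ e ∈ E, (1 / 8) * ((1 / τ) * ∫ t in (0:ℝ)..τ, R e t) = Castar / 4 := by
    rw [← Finset.mul_sum, hCastar]
    simp only [R, D, a]
    ring
  rw [← div_div]
  gcongr
  exact hLR.trans_eq hC
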